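/- (The transformation formula holds modulo p.) Let p be a prime, s ∈ ℤ_{≥1}, a ∈ ℤ_p ∖ ℤ_{≤0}, and c ∈ 1+qW; let σ(t) = c t^p and σ̂(t) = c^{−1} t^p. Let B^G_k denote the coefficients of G^{(σ)}_{a,…,a}(t) (so B^G_0 = s·D(a) − p^{−1}log(c) and B^G_k = k^{−1}(A_k − c^{k/p} A^{(1)}_{k/p}) for k ≥ 1), and let B̂_k := (k+a)^{−1}(A_k − (−1)^{se} A^{(1)}_{(k−l)/p} (c^{−1})^{(k+a)/p}) denote the coefficients of Ĝ^{(σ̂)}_{a,…,a}(t). Then B^G_k ∈ pW and B̂_k ∈ pW for every k with l < k ≤ p−1, and B^G_k + (−1)^{ls} B̂_{l−k} ∈ pW for every k with 0 ≤ k ≤ l; equivalently, G^{(σ)}_{a,…,a}(t)_{<p} + (−1)^{ls} t^l · Ĝ^{(σ̂)}_{a,…,a}(t^{−1})_{<p} ≡ 0 mod p W[t, t^{−1}]. -/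

import Mathlib

open scoped Classical

namespace HGP

/-- `𝔽̄_p`, an algebraic closure of the prime field `𝔽_p`. -/
abbrev Fbar (p : ℕ) [Fact p.Prime] : Type _ := AlgebraicClosure (ZMod p)

/-- `W = W(𝔽̄_p)`, the ring of Witt vectors of `𝔽̄_p`. -/
abbrev Wp (p : ℕ) [Fact p.Prime] : Type _ := WittVector p (Fbar p)

/-- `K = Frac W`. -/
abbrev Kp (p : ℕ) [Fact p.Prime] : Type _ := FractionRing (Wp p)

/-- The canonical embedding `ℤ_p = W(𝔽_p) → W(𝔽̄_p)`. -/
noncomputable def iota (p : ℕ) [Fact p.Prime] : ℤ_[p] →+* Wp p :=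
  (WittVector.map (algebraMap (ZMod p) (Fbar p))).comp (WittVector.equiv p).symm.toRingHom

/-- The canonical embedding `W → K`. -/
noncomputable def iotaK (p : ℕ) [Fact p.Prime] : Wp p →+* Kp p := algebraMap (Wp p) (Kp p)

/-- `l`: the unique integer in `{0,…,p−1}` with `a + l ≡ 0 mod p`. -/
noncomputable def dl (p : ℕ) [Fact p.Prime] (a : ℤ_[p]) : ℕ := (-a).appr 1

/-- `q := 4` if `p = 2` and `q := p` otherwise. -/
def qq (p : ℕ) : ℕ := if p = 2 then 4 else p

/-- `l′`: the unique integer in `{0,…,q−1}` with `a + l′ ≡ 0 mod q`. -/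
noncomputable def dl' (p : ℕ) [Fact p.Prime] (a : ℤ_[p]) : ℕ :=
  (-a).appr (if p = 2 then 2 else 1)

/-- `e := l′ − ⌊l′/p⌋`. -/
noncomputable def de (p : ℕ) [Fact p.Prime] (a : ℤ_[p]) : ℕ := dl' p a - dl' p a / p

/-- `a ∈ ℤ_p ∖ ℤ_{≤0}`, i.e. `a` is not a nonpositive rational integer. -/
def NotNonposInt (p : ℕ) [Fact p.Prime] (a : ℤ_[p]) : Prop := ∀ n : ℕ, a + (n : ℤ_[p]) ≠ 0

/-- `a′` is the Dwork prime of `a`, i.e. `p·a′ = a + l`. -/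
def IsDworkPrime (p : ℕ) [Fact p.Prime] (a a' : ℤ_[p]) : Prop :=
  (p : ℤ_[p]) * a' = a + (dl p a : ℤ_[p])

/-- `A k = ((a)_k / k!)^s ∈ ℤ_p`, characterized by `k!^s · A k = ((a)_k)^s`. -/
def IsHGCoeff (p : ℕ) [Fact p.Prime] (s : ℕ) (a : ℤ_[p]) (A : ℕ → ℤ_[p]) : Prop :=
  ∀ k : ℕ, (k.factorial : ℤ_[p]) ^ s * A k = ((ascPochhammer ℤ_[p] k).eval a) ^ s

/-- `f = (α ↦ c^α)` for `c ∈ 1 + pW`: `c^α` is uniquely characterized by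
`c^α ≡ c^{α_n} mod p^n W` for any natural approximation `α_n` of `α` mod `p^n`. -/
def IsCpow (p : ℕ) [Fact p.Prime] (c : Wp p) (f : ℤ_[p] → Wp p) : Prop :=
  ∀ (α : ℤ_[p]) (n : ℕ), f α - c ^ (α.appr n) ∈ Ideal.span {(p : Wp p) ^ n}

/-- The coefficients `B_k` of `Ĝ^{(σ)}_{a,…,a}(t)`, as elements of `K = Frac W`:
`B_k = (k+a)⁻¹ (A_k − (−1)^{se} A^{(1)}_{(k−l)/p} c^{(k−l)/p + a′})`. -/
noncomputable def BhatK (p : ℕ) [Fact p.Prime] (s : ℕ) (a a' : ℤ_[p]) (A A1 : ℕ → ℤ_[p])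
    (cpw : ℤ_[p] → Wp p) (k : ℕ) : Kp p :=
  ((k : Kp p) + iotaK p (iota p a))⁻¹ *
    (iotaK p (iota p (A k)) -
      (if dl p a ≤ k ∧ p ∣ (k - dl p a) then
        (-1 : Kp p) ^ (s * de p a) * iotaK p (iota p (A1 ((k - dl p a) / p))) *
          iotaK p (cpw ((((k - dl p a) / p : ℕ) : ℤ_[p]) + a'))
      else 0))

/-- `B : ℕ → W` is the coefficient function of `Ĝ^{(σ)}_{a,…,a}(t)`, characterized in `W` by
`(k+a)·B_k = A_k − (−1)^{se} A^{(1)}_{(k−l)/p} c^{(k−l)/p + a′}`. -/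
def IsBhat (p : ℕ) [Fact p.Prime] (s : ℕ) (a a' : ℤ_[p]) (A A1 : ℕ → ℤ_[p])
    (cpw : ℤ_[p] → Wp p) (B : ℕ → Wp p) : Prop :=
  ∀ k : ℕ, ((k : Wp p) + iota p a) * B k =
    iota p (A k) -
      (if dl p a ≤ k ∧ p ∣ (k - dl p a) then
        (-1 : Wp p) ^ (s * de p a) * iota p (A1 ((k - dl p a) / p)) *
          cpw ((((k - dl p a) / p : ℕ) : ℤ_[p]) + a')
      else 0)

/-- A function `ℕ → K` is Lipschitz: it takes values in `W` and
`p^m ∣ (n − n′)` implies `f n − f n′ ∈ p^m W`. -/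
def LipschitzSeq (p : ℕ) [Fact p.Prime] (f : ℕ → Kp p) : Prop :=
  (∀ n : ℕ, f n ∈ (iotaK p).range) ∧
    ∀ n n' m : ℕ, ((p : ℤ) ^ m ∣ (n : ℤ) - (n' : ℤ)) →
      ∃ w : Wp p, f n - f n' = (p : Kp p) ^ m * iotaK p w

/-- `L` is the `p`-adic limit of the sequence `s` in `W`. -/
def WLim (p : ℕ) [Fact p.Prime] (s : ℕ → Wp p) (L : Wp p) : Prop :=
  ∀ m : ℕ, ∃ M : ℕ, ∀ n ≥ M, L - s n ∈ Ideal.span {(p : Wp p) ^ m}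

/-- `{α}_k := Π_{1 ≤ i ≤ k, p ∤ (α+i−1)} (α+i−1)`. -/
noncomputable def curly (p : ℕ) [Fact p.Prime] (α : ℤ_[p]) (k : ℕ) : ℤ_[p] :=
  ∏ j ∈ Finset.range k, if (p : ℤ_[p]) ∣ (α + (j : ℤ_[p])) then 1 else (α + (j : ℤ_[p]))

/-- `W/p^n W`. -/
abbrev Qn (p : ℕ) [Fact p.Prime] (n : ℕ) := Wp p ⧸ Ideal.span {(p : Wp p) ^ n}

/-- Laurent polynomials over `W/p^n`, obtained from polynomials over `W`. -/
noncomputable def laurentOfPolyW (p : ℕ) [Fact p.Prime] (n : ℕ) :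
    Polynomial (Wp p) →+* LaurentPolynomial (Qn p n) :=
  (Polynomial.toLaurent).comp
    (Polynomial.mapRingHom (Ideal.Quotient.mk (Ideal.span {(p : Wp p) ^ n})))

/-- `R_n := (W/p^n)[t,t⁻¹, h(t)⁻¹]`, the localization of the Laurent polynomial ring
over `W/p^n` away from (the image of) `h`. -/
abbrev Rn (p : ℕ) [Fact p.Prime] (h : Polynomial (Wp p)) (n : ℕ) :=
  Localization.Away (laurentOfPolyW p n h)

/-- The canonical map from Laurent polynomials over `W/p^n` to `R_n`. -/
noncomputable def mkRn (p : ℕ) [Fact p.Prime] (h : Polynomial (Wp p)) (n : ℕ) :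
    LaurentPolynomial (Qn p n) →+* Rn p h n := algebraMap _ _

/-- The canonical map from polynomials over `W` to `R_n`. -/
noncomputable def toRn (p : ℕ) [Fact p.Prime] (h : Polynomial (Wp p)) (n : ℕ) :
    Polynomial (Wp p) →+* Rn p h n := (mkRn p h n).comp (laurentOfPolyW p n)



lemma toZMod_eq_zero (p : ℕ) [Fact p.Prime] (x : ℤ_[p]) :
    PadicInt.toZMod x = 0 ↔ (p : ℤ_[p]) ∣ x := by
  rw [← RingHom.mem_ker, PadicInt.ker_toZMod, PadicInt.maximalIdeal_eq_span_p,
    Ideal.mem_span_singleton]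

lemma dvd_of_toZMod_eq (p : ℕ) [Fact p.Prime] (x y : ℤ_[p])
    (h : PadicInt.toZMod x = PadicInt.toZMod y) : (p : ℤ_[p]) ∣ x - y := by
  rw [← toZMod_eq_zero, map_sub, h, sub_self]

lemma nat_inv (p : ℕ) [Fact p.Prime] (j : ℕ) (hj : ¬ p ∣ j) :
    ∃ g : ℤ_[p], (j : ℤ_[p]) * g = 1 ∧ PadicInt.toZMod g = ((j : ZMod p))⁻¹ := by
  have hu : IsUnit (j : ℤ_[p]) := by
    rw [PadicInt.isUnit_iff]
    by_contra hne
    have h1 : ‖(j : ℤ_[p])‖ < 1 := lt_of_le_of_ne (PadicInt.norm_le_one _) hne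
    rw [PadicInt.norm_lt_one_iff_dvd, ← toZMod_eq_zero, map_natCast,
      ZMod.natCast_eq_zero_iff] at h1
    exact hj h1
  obtain ⟨g, hg⟩ := hu.exists_right_inv
  refine ⟨g, hg, ?_⟩
  have h2 := congrArg PadicInt.toZMod hg
  rw [map_mul, map_natCast, map_one] at h2
  exact eq_inv_of_mul_eq_one_right h2

lemma coprime_dvd (p : ℕ) [Fact p.Prime] {R : Type*} [CommRing R] (j : ℕ) (hj : ¬ p ∣ j) (x : R)
    (h : (p : R) ∣ (j : R) * x) : (p : R) ∣ x := by
  have hc : IsCoprime (p : R) (j : R) := by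
    have : Nat.Coprime p j := (Nat.Prime.coprime_iff_not_dvd Fact.out).2 hj
    have h2 := (Nat.isCoprime_iff_coprime.2 this).map (Int.castRingHom R)
    simpa using h2
  exact hc.dvd_of_dvd_mul_left h

lemma fact_not_dvd (p : ℕ) [hp : Fact p.Prime] (k s : ℕ) (hk : k < p) :
    ¬ p ∣ k.factorial ^ s := by
  intro h
  have := hp.out.dvd_of_dvd_pow h
  rw [hp.out.dvd_factorial] at this
  omega

lemma eval_toZMod (p : ℕ) [Fact p.Prime] (a : ℤ_[p]) (k : ℕ) :
    PadicInt.toZMod ((ascPochhammer ℤ_[p] k).eval a)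
      = (ascPochhammer (ZMod p) k).eval (PadicInt.toZMod a) := by
  rw [← ascPochhammer_map (PadicInt.toZMod (p := p)), Polynomial.eval_map, Polynomial.eval₂_hom]

lemma toZMod_a (p : ℕ) [Fact p.Prime] (a a' : ℤ_[p]) (ha' : IsDworkPrime p a a') :
    PadicInt.toZMod a = -((dl p a : ℕ) : ZMod p) := by
  have h := congrArg PadicInt.toZMod ha'
  simp only [map_mul, map_natCast, map_add] at h
  rw [ZMod.natCast_self, zero_mul] at h
  exact eq_neg_of_add_eq_zero_left h.symm

lemma dl_lt (p : ℕ) [Fact p.Prime] (a : ℤ_[p]) : dl p a < p := by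
  have := PadicInt.appr_lt (-a) 1
  simpa [dl] using this

lemma A_big (p : ℕ) [Fact p.Prime] (s : ℕ) (hs : 1 ≤ s) (a a' : ℤ_[p])
    (ha' : IsDworkPrime p a a') (A : ℕ → ℤ_[p]) (hA : IsHGCoeff p s a A) (k : ℕ)
    (hk : dl p a < k) (hkp : k < p) : (p : ℤ_[p]) ∣ A k := by
  refine coprime_dvd p (k.factorial ^ s) (fact_not_dvd p k s hkp) _ ?_
  push_cast
  rw [hA k, ← toZMod_eq_zero, map_pow, eval_toZMod, toZMod_a p a a' ha',
    ascPochhammer_eval_neg_coe_nat_of_lt hk, zero_pow (by omega)]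

lemma A_small (p : ℕ) [Fact p.Prime] (s : ℕ) (a a' : ℤ_[p])
    (ha' : IsDworkPrime p a a') (A : ℕ → ℤ_[p]) (hA : IsHGCoeff p s a A) (k : ℕ)
    (hk : k ≤ dl p a) : PadicInt.toZMod (A k) = ((-1) ^ k * ((dl p a).choose k : ZMod p)) ^ s := by
  have hkp : k < p := lt_of_le_of_lt hk (dl_lt p a)
  have h := congrArg PadicInt.toZMod (hA k)
  rw [map_mul, map_pow, map_pow, map_natCast, eval_toZMod, toZMod_a p a a' ha',
    ascPochhammer_eval_neg_eq_descPochhammer, descPochhammer_eval_eq_descFactorial,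
    Nat.descFactorial_eq_factorial_mul_choose] at h
  have h0 : (k.factorial : ZMod p) ^ s ≠ 0 := by
    have := fact_not_dvd p k s hkp
    rw [← ZMod.natCast_eq_zero_iff] at this
    exact_mod_cast this
  apply mul_left_cancel₀ h0
  rw [h]
  push_cast
  rw [← mul_pow]
  congr 1
  ring

lemma poch_expand (p : ℕ) [Fact p.Prime] (x : ℤ_[p]) (l : ℕ) (hl : l < p) :
    ∃ h r : ℤ_[p], PadicInt.toZMod h = ∑ j ∈ Finset.range l, (((j + 1 : ℕ)) : ZMod p)⁻¹ ∧
      (ascPochhammer ℤ_[p] l).eval (x - (l : ℤ_[p]))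
        = (-1) ^ l * (l.factorial : ℤ_[p]) * (1 - x * h + x ^ 2 * r) := by
  induction l with
  | zero => exact ⟨0, 0, by simp, by simp⟩
  | succ l ih =>
    obtain ⟨h, r, hh, hr⟩ := ih (by omega)
    obtain ⟨g, hg, hg2⟩ := nat_inv p (l + 1) (fun hd => by
      have := Nat.le_of_dvd (by omega) hd
      omega)
    refine ⟨h + g, r + g * h - x * g * r, ?_, ?_⟩
    · rw [Finset.sum_range_succ, map_add, hh, hg2]
    · rw [ascPochhammer_succ_left, Polynomial.eval_mul, Polynomial.eval_X, Polynomial.eval_comp]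
      have : Polynomial.eval (x - ((l + 1 : ℕ) : ℤ_[p])) (Polynomial.X + 1) = x - (l : ℤ_[p]) := by
        simp
        ring
      rw [this, hr, Nat.factorial_succ]
      push_cast at hg ⊢
      linear_combination (-1) ^ l * (l.factorial : ℤ_[p]) * (1 - x * h + x ^ 2 * r) * x * (-hg)

lemma pow_expand {R : Type*} [CommRing R] (x h r : R) (s : ℕ) :
    ∃ r', (1 - x * h + x ^ 2 * r) ^ s = 1 - s * x * h + x ^ 2 * r' := by
  induction s with
  | zero => exact ⟨0, by simp⟩
  | succ s ih =>
    obtain ⟨r', hr'⟩ := ih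
    refine ⟨s * h * h + r' * (1 - x * h + x ^ 2 * r) + r - s * x * h * r, ?_⟩
    rw [pow_succ, hr']
    push_cast
    ring

lemma A_l (p : ℕ) [Fact p.Prime] (s : ℕ) (a a' : ℤ_[p])
    (ha' : IsDworkPrime p a a') (A : ℕ → ℤ_[p]) (hA : IsHGCoeff p s a A) :
    ∃ h r : ℤ_[p], PadicInt.toZMod h =
        ∑ j ∈ Finset.range (dl p a), (((j + 1 : ℕ)) : ZMod p)⁻¹ ∧
      A (dl p a) = (-1) ^ (dl p a * s) * (1 - s * (p * a') * h + (p * a') ^ 2 * r) := by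
  obtain ⟨h, r, hh, hr⟩ := poch_expand p (p * a') (dl p a) (dl_lt p a)
  obtain ⟨r', hr'⟩ := pow_expand (p * a') h r s
  refine ⟨h, r', hh, ?_⟩
  have h1 := hA (dl p a)
  have h2 : (p : ℤ_[p]) * a' - (dl p a : ℤ_[p]) = a := by rw [ha']; ring
  rw [h2] at hr
  rw [hr, mul_pow, hr', mul_pow, ← pow_mul] at h1
  have h0 : ((dl p a).factorial : ℤ_[p]) ^ s ≠ 0 :=
    pow_ne_zero _ (by exact_mod_cast Nat.factorial_ne_zero _)
  apply mul_left_cancel₀ h0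
  rw [h1]
  ring

lemma w_dvd (p : ℕ) [hp : Fact p.Prime] (w : ℕ → ℤ_[p])
    (hw : ∀ i : ℕ, 1 ≤ i → ((i : ℤ_[p]) * (p : ℤ_[p])) * w i = ((qq p : ℤ_[p])) ^ i)
    (i : ℕ) (hi : 2 ≤ i) : (p : ℤ_[p]) ∣ w i := by
  obtain ⟨v, m, hm, him⟩ := Nat.exists_eq_pow_mul_and_not_dvd (n := i) (by omega) p hp.out.ne_one
  have hm0 : m ≠ 0 := by rintro rfl; simp at hm
  have hle : p ^ v ≤ i := by
    rw [him]; exact Nat.le_mul_of_pos_right _ (by omega)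
  have hdq : p ^ (v + 2) ∣ qq p ^ i := by
    unfold qq
    split_ifs with h2
    · subst h2
      have : v < i := lt_of_lt_of_le Nat.lt_two_pow_self hle
      rw [show (4 : ℕ) = 2 ^ 2 by norm_num, ← pow_mul]
      exact pow_dvd_pow _ (by omega)
    · have h3 : 3 ≤ p := by
        have := hp.out.two_le
        omega
      apply pow_dvd_pow
      by_contra hlt
      have h4 : 3 ^ (i - 1) ≤ i :=
        le_trans (le_trans (Nat.pow_le_pow_left h3 _)
          (Nat.pow_le_pow_right (by omega) (by omega))) hle
      obtain ⟨j, rfl⟩ : ∃ j, i = j + 2 := ⟨i - 2, by omega⟩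
      have h5 : j < 3 ^ j := Nat.lt_pow_self (by norm_num)
      simp only [show j + 2 - 1 = j + 1 by omega, pow_succ] at h4
      omega
  obtain ⟨r, hr⟩ := hdq
  have h1 := hw i (by omega)
  have h6 : (qq p : ℤ_[p]) ^ i = (p : ℤ_[p]) ^ (v + 2) * r := by exact_mod_cast congrArg (Nat.cast : ℕ → ℤ_[p]) hr
  have h7 : (i : ℤ_[p]) = (p : ℤ_[p]) ^ v * m := by exact_mod_cast congrArg (Nat.cast : ℕ → ℤ_[p]) him
  apply coprime_dvd p m hm
  refine ⟨r, ?_⟩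
  have hp0 : (p : ℤ_[p]) ^ (v + 1) ≠ 0 := pow_ne_zero _ (by exact_mod_cast hp.out.ne_zero)
  apply mul_left_cancel₀ hp0
  rw [h6, h7] at h1
  linear_combination h1

lemma pow_expand2 (p : ℕ) [hp : Fact p.Prime] {R : Type*} [CommRing R] (io : ℤ_[p] →+* R)
    (w : ℕ → ℤ_[p])
    (hw : ∀ i : ℕ, 1 ≤ i → ((i : ℤ_[p]) * (p : ℤ_[p])) * w i = ((qq p : ℤ_[p])) ^ i)
    (y : R) (N : ℕ) :
    ∃ r : R, (1 + (qq p : R) * y) ^ N = 1 + N * p * io (w 1) * y + p ^ 2 * N * r := by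
  cases N with
  | zero => exact ⟨0, by simp⟩
  | succ M =>
    have key : (p : R) ^ 2 * ((M + 1 : ℕ) : R) ∣ ∑ i ∈ Finset.range M,
        ((qq p : R) * y) ^ (i + 1 + 1) * 1 ^ (M + 1 - (i + 1 + 1)) *
          ((M + 1).choose (i + 1 + 1) : R) := by
      apply Finset.dvd_sum
      intro i _
      obtain ⟨z, hz⟩ := w_dvd p w hw (i + 2) (by omega)
      have h1 := congrArg io (hw (i + 2) (by omega))
      rw [hz] at h1
      simp only [map_mul, map_pow, map_natCast] at h1
      have h2 := congrArg (Nat.cast : ℕ → R) (Nat.add_one_mul_choose_eq M (i + 1))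
      push_cast at h1 h2 ⊢
      refine ⟨io z * y ^ (i + 2) * (M.choose (i + 1) : R), ?_⟩
      rw [mul_pow, one_pow, show i + 1 + 1 = i + 2 from rfl, ← h1]
      linear_combination (-(p : R) ^ 2 * io z * y ^ (i + 2)) * h2
    obtain ⟨r, hr⟩ := key
    refine ⟨r, ?_⟩
    have h1 := congrArg io (hw 1 le_rfl)
    simp only [map_mul, map_pow, map_natCast] at h1
    rw [add_comm 1, add_pow, Finset.sum_range_succ', Finset.sum_range_succ', hr]
    simp only [zero_add, pow_one, one_pow, pow_zero, Nat.choose_one_right, Nat.choose_zero_right]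
    push_cast at h1 ⊢
    linear_combination (-((M : R) + 1) * y) * h1

lemma harm_shift (p : ℕ) [Fact p.Prime] (n l : ℕ) (h : p ∣ n + l) :
    ∑ j ∈ Finset.range (n + l), ((j : ZMod p))⁻¹ = ∑ j ∈ Finset.range n, ((j : ZMod p))⁻¹
      - ∑ j ∈ Finset.range l, ((j + 1 : ℕ) : ZMod p)⁻¹ := by
  rw [Finset.sum_range_add, sub_eq_add_neg, ← Finset.sum_neg_distrib,
    ← Finset.sum_range_reflect (fun x => ((n + x : ℕ) : ZMod p)⁻¹)]
  congr 1
  apply Finset.sum_congr rfl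
  intro j hj
  have hj' := Finset.mem_range.1 hj
  have h1 : ((n + l : ℕ) : ZMod p) = 0 := (ZMod.natCast_eq_zero_iff _ _).2 h
  have h2 : n + (l - 1 - j) + (j + 1) = n + l := by omega
  rw [← h2, Nat.cast_add] at h1
  rw [eq_neg_of_add_eq_zero_left h1, inv_neg]

lemma harm_mul (p : ℕ) [Fact p.Prime] (t : ℕ) :
    ∑ j ∈ Finset.range (p * t), ((j : ZMod p))⁻¹
      = t * ∑ j ∈ Finset.range p, ((j : ZMod p))⁻¹ := by
  induction t with
  | zero => simp
  | succ t ih =>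
    rw [Nat.mul_succ, Finset.sum_range_add, ih]
    simp
    ring

lemma harm_odd (p : ℕ) [hp : Fact p.Prime] (h2 : p ≠ 2) :
    ∑ j ∈ Finset.range p, ((j : ZMod p))⁻¹ = 0 := by
  have hp2 := hp.out.two_le
  have h := harm_shift p 1 (p - 1) (by rw [show 1 + (p - 1) = p by omega])
  have h3 : ∑ j ∈ Finset.range p, ((j : ZMod p))⁻¹
      = ∑ j ∈ Finset.range (p - 1), ((j + 1 : ℕ) : ZMod p)⁻¹ := by
    obtain ⟨m, rfl⟩ : ∃ m, p = m + 1 := ⟨p - 1, by omega⟩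
    rw [Finset.sum_range_succ']
    simp
  rw [show 1 + (p - 1) = p by omega, ← h3] at h
  simp only [Finset.sum_range_one, Nat.cast_zero, inv_zero, zero_sub] at h
  have h4 : (2 : ZMod p) * ∑ j ∈ Finset.range p, ((j : ZMod p))⁻¹ = 0 := by
    linear_combination h
  rcases mul_eq_zero.1 h4 with h5 | h5
  · have : ((2 : ℕ) : ZMod p) = 0 := by exact_mod_cast h5
    rw [ZMod.natCast_eq_zero_iff] at this
    have := Nat.le_of_dvd (by norm_num) this
    omega
  · exact h5

lemma D_sum (p : ℕ) [Fact p.Prime] (m : ℕ) :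
    ∃ S : ℤ_[p], (S : ℚ_[p]) =
      ∑ j ∈ (Finset.Icc 1 m).filter (fun j => ¬ (p ∣ j)), ((j : ℚ_[p]))⁻¹ ∧
      PadicInt.toZMod S = ∑ j ∈ Finset.range (m + 1), ((j : ZMod p))⁻¹ := by
  induction m with
  | zero => exact ⟨0, by simp, by simp⟩
  | succ m ih =>
    obtain ⟨S, h1, h2⟩ := ih
    rw [← Finset.insert_Icc_right_eq_Icc_add_one (by omega), Finset.filter_insert]
    by_cases hd : p ∣ m + 1
    · refine ⟨S, ?_, ?_⟩
      · rw [if_neg (by simpa using hd), h1]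
      · rw [Finset.sum_range_succ, ← h2, (ZMod.natCast_eq_zero_iff _ _).2 hd, inv_zero, add_zero]
    · obtain ⟨g, hg, hg2⟩ := nat_inv p (m + 1) hd
      refine ⟨S + g, ?_, ?_⟩
      · rw [if_pos hd, Finset.sum_insert (by simp), ← h1, PadicInt.coe_add, add_comm]
        congr 1
        have := congrArg (fun z : ℤ_[p] => (z : ℚ_[p])) hg
        simp only [PadicInt.coe_mul, PadicInt.coe_natCast, PadicInt.coe_one] at this
        exact eq_inv_of_mul_eq_one_right this
      · rw [Finset.sum_range_succ, map_add, h2, hg2]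

lemma D_mod (p : ℕ) [hp : Fact p.Prime] (a a' : ℤ_[p]) (ha' : IsDworkPrime p a a')
    (D : ℤ_[p] → ℚ_[p]) (hDcont : Continuous D)
    (hDval : ∀ m : ℕ, D (1 + (m : ℤ_[p])) =
      ∑ j ∈ (Finset.Icc 1 m).filter (fun j => ¬ (p ∣ j)), ((j : ℚ_[p]))⁻¹)
    (Da : ℤ_[p]) (hDa : (Da : ℚ_[p]) = D a) :
    PadicInt.toZMod Da = ∑ j ∈ Finset.range (dl p a), ((j + 1 : ℕ) : ZMod p)⁻¹
      + PadicInt.toZMod a' * ∑ j ∈ Finset.range p, ((j : ZMod p))⁻¹ := by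
  obtain ⟨δ, hδ, hδ2⟩ := Metric.continuous_iff.1 hDcont a 1 one_pos
  obtain ⟨n0, hn0⟩ := PadicInt.exists_pow_neg_lt p hδ
  set n := n0 + 2 with hn
  set m := (a - 1).appr n with hm
  have hspec := PadicInt.appr_spec n (a - 1)
  rw [← hm] at hspec
  have hnorm : ‖a - 1 - (m : ℤ_[p])‖ < δ := by
    refine lt_of_le_of_lt ?_ hn0
    rw [PadicInt.norm_le_pow_iff_mem_span_pow]
    rw [Ideal.mem_span_singleton] at hspec ⊢
    exact dvd_trans (pow_dvd_pow _ (by omega)) hspec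
  obtain ⟨S, hS1, hS2⟩ := D_sum p m
  have hd := hδ2 (1 + (m : ℤ_[p])) (by
    rw [dist_comm, dist_eq_norm]
    rwa [show a - (1 + (m : ℤ_[p])) = a - 1 - m by ring])
  rw [hDval m, ← hS1, ← hDa, dist_eq_norm, ← PadicInt.coe_sub, PadicInt.padic_norm_e_of_padicInt,
    PadicInt.norm_lt_one_iff_dvd, ← toZMod_eq_zero, map_sub, sub_eq_zero] at hd
  rw [← hd, hS2]
  rw [Ideal.mem_span_singleton] at hspec
  obtain ⟨z, hz⟩ := dvd_trans (pow_dvd_pow (p : ℤ_[p]) (show 2 ≤ n by omega)) hspec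
  have ha2 : (p : ℤ_[p]) * a' = a + (dl p a : ℤ_[p]) := ha'
  have hdv : p ∣ (m + 1) + dl p a := by
    rw [← ZMod.natCast_eq_zero_iff]
    have : PadicInt.toZMod (((m + 1 + dl p a : ℕ)) : ℤ_[p]) = 0 := by
      rw [toZMod_eq_zero]
      refine ⟨a' - p * z, ?_⟩
      push_cast
      linear_combination -hz - ha2
    rwa [map_natCast] at this
  have h1 := harm_shift p (m + 1) (dl p a) hdv
  obtain ⟨t, ht⟩ := hdv
  rw [ht, harm_mul] at h1
  have h3 : PadicInt.toZMod a' = (t : ZMod p) := by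
    have hp0 : (p : ℤ_[p]) ≠ 0 := by exact_mod_cast hp.out.ne_zero
    have : a' = t + p * z := by
      apply mul_left_cancel₀ hp0
      have := congrArg (Nat.cast : ℕ → ℤ_[p]) ht
      push_cast at this
      linear_combination hz + ha2 + this
    rw [this]
    simp
  rw [h3]
  linear_combination -h1

lemma sign_lem (p : ℕ) [hp : Fact p.Prime] (s : ℕ) (a a' : ℤ_[p]) (ha' : IsDworkPrime p a a') :
    ∃ d r : ℤ_[p], PadicInt.toZMod d
        = - (PadicInt.toZMod a' * ∑ j ∈ Finset.range p, ((j : ZMod p))⁻¹) ∧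
      (-1 : ℤ_[p]) ^ (s * de p a) = (-1) ^ (dl p a * s)
        * (1 - p * a' * s * d + p ^ 2 * a' * r) := by
  by_cases h2 : p = 2
  · subst h2
    have ha2 : ((2 : ℕ) : ℤ_[2]) * a' = a + (dl 2 a : ℤ_[2]) := ha'
    have hS : ∑ j ∈ Finset.range 2, ((j : ZMod 2))⁻¹ = 1 := by simp [Finset.sum_range_succ]
    have hlt := dl_lt 2 a
    have hL : dl' 2 a < 4 := by
      have := PadicInt.appr_lt (-a) 2
      simpa [dl'] using this
    have hle : dl 2 a ≤ dl' 2 a := by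
      simp only [dl, dl', if_true]
      exact PadicInt.appr_mono _ (by norm_num)
    have hdv : 2 ∣ dl' 2 a - dl 2 a := by
      simp only [dl, dl', if_true]
      simpa using PadicInt.dvd_appr_sub_appr (-a) 1 2 (by norm_num)
    obtain ⟨b, hb⟩ := hdv
    have hLb : dl' 2 a = dl 2 a + 2 * b := by omega
    have hde : de 2 a = dl 2 a + b := by
      unfold de
      omega
    have hsp := PadicInt.appr_spec 2 (-a)
    have hL2 : (-a).appr 2 = dl' 2 a := by simp [dl']
    rw [hL2, hLb, Ideal.mem_span_singleton] at hsp
    obtain ⟨z, hz⟩ := hsp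
    have h20 : (2 : ℤ_[2]) ≠ 0 := by norm_num
    have hab : a' = -b - 2 * z := by
      apply mul_left_cancel₀ h20
      push_cast at ha2 hz
      linear_combination ha2 - hz
    have hb1 : b = 0 ∨ b = 1 := by omega
    rw [hde, hS]
    have h22 : PadicInt.toZMod (2 : ℤ_[2]) = 0 := (toZMod_eq_zero 2 2).2 (by simp)
    rcases hb1 with rfl | rfl
    · refine ⟨0, 0, ?_, ?_⟩
      · rw [hab]
        simp [h22]
      · simp [mul_comm]
    · have hu : ∃ g, a' * g = 1 := by
        have hnd : ¬ ((2 : ℕ) : ℤ_[2]) ∣ a' := by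
          rw [← toZMod_eq_zero, hab]
          simp [h22]
        rw [← PadicInt.norm_lt_one_iff_dvd] at hnd
        have : IsUnit a' := by
          rw [PadicInt.isUnit_iff]
          exact le_antisymm (PadicInt.norm_le_one _) (not_lt.1 hnd)
        exact this.exists_right_inv
      obtain ⟨g, hg⟩ := hu
      have hmap : PadicInt.toZMod (1 : ℤ_[2]) = -(PadicInt.toZMod a' * 1) := by
        rw [hab]
        simp [h22]
      rcases Nat.even_or_odd' s with ⟨k, rfl | rfl⟩
      · refine ⟨1, k, hmap, ?_⟩
        rw [show 2 * k * (dl 2 a + 1) = dl 2 a * (2 * k) + 2 * k by ring, pow_add]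
        congr 1
        rw [pow_mul]
        push_cast
        simp
        ring
      · refine ⟨1, k + g * (-z - 1), hmap, ?_⟩
        rw [show (2 * k + 1) * (dl 2 a + 1) = dl 2 a * (2 * k + 1) + (2 * k + 1) by ring, pow_add]
        congr 1
        rw [pow_succ, pow_mul]
        push_cast at hab ⊢
        simp
        linear_combination 2 * hab + 4 * (1 + z) * hg
  · refine ⟨0, 0, ?_, ?_⟩
    · rw [harm_odd p h2]; simp
    · have : de p a = dl p a := by
        have h1 : dl' p a = dl p a := by simp [dl', dl, h2]
        rw [de, h1, Nat.div_eq_of_lt (dl_lt p a), Nat.sub_zero]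
      rw [this]
      simp [mul_comm]

lemma iota_inj (p : ℕ) [Fact p.Prime] : Function.Injective (iota p) := by
  unfold iota
  rw [RingHom.coe_comp]
  exact (WittVector.map_injective _ (algebraMap (ZMod p) (Fbar p)).injective).comp
    (WittVector.equiv p).symm.injective

lemma iota_dvd (p : ℕ) [Fact p.Prime] (x : ℤ_[p]) (h : (p : ℤ_[p]) ∣ x) :
    (p : Wp p) ∣ iota p x := by
  simpa using map_dvd (iota p) h

lemma Lg_mod (p : ℕ) [hp : Fact p.Prime] (u : Wp p) (w : ℕ → ℤ_[p])
    (hw : ∀ i : ℕ, 1 ≤ i → ((i : ℤ_[p]) * (p : ℤ_[p])) * w i = ((qq p : ℤ_[p])) ^ i)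
    (Lg : Wp p)
    (hLg : WLim p (fun n => ∑ i ∈ Finset.Icc 1 n, (-1 : Wp p) ^ (i + 1) * iota p (w i) * u ^ i)
      Lg) : (p : Wp p) ∣ Lg - iota p (w 1) * u := by
  obtain ⟨M, hM⟩ := hLg 1
  have h1 := hM (M + 1) (by omega)
  simp only at h1
  rw [pow_one, Ideal.mem_span_singleton, ← Finset.sum_erase_add _ _
    (show 1 ∈ Finset.Icc 1 (M + 1) by simp)] at h1
  have h2 : (p : Wp p) ∣ ∑ i ∈ (Finset.Icc 1 (M + 1)).erase 1,
      (-1 : Wp p) ^ (i + 1) * iota p (w i) * u ^ i := by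
    apply Finset.dvd_sum
    intro i hi
    simp only [Finset.mem_erase, Finset.mem_Icc] at hi
    exact ((iota_dvd p _ (w_dvd p w hw i (by omega))).mul_left _).mul_right _
  obtain ⟨x, hx⟩ := h1
  obtain ⟨y, hy⟩ := h2
  rw [hy] at hx
  exact ⟨x + y, by linear_combination hx⟩

lemma cpow_mod (p : ℕ) [hp : Fact p.Prime] (a' : ℤ_[p]) (ha0 : a' ≠ 0) (u c chat : Wp p)
    (hc : c = 1 + (qq p : Wp p) * u) (hchat : c * chat = 1)
    (cpwhat : ℤ_[p] → Wp p) (hcpwhat : IsCpow p chat cpwhat) (w : ℕ → ℤ_[p])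
    (hw : ∀ i : ℕ, 1 ≤ i → ((i : ℤ_[p]) * (p : ℤ_[p])) * w i = ((qq p : ℤ_[p])) ^ i) :
    ∃ r : Wp p, cpwhat a' = 1 - p * iota p a' * iota p (w 1) * u + p ^ 2 * iota p a' * r := by
  have hq : (qq p : Wp p) = p * iota p (w 1) := by
    have := congrArg (iota p) (hw 1 le_rfl)
    simp only [map_mul, map_pow, map_natCast] at this
    simpa using this.symm
  set n := a'.valuation + 2 with hn
  have hval : (p : ℤ_[p]) ^ n ∣ p ^ 2 * a' := by
    have h1 := PadicInt.unitCoeff_spec ha0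
    obtain ⟨v, hv⟩ := (PadicInt.unitCoeff ha0).isUnit.exists_right_inv
    refine ⟨(PadicInt.unitCoeff ha0 : ℤ_[p]), ?_⟩
    conv_lhs => rw [h1]
    rw [hn]
    ring
  have hval2 : (p : ℤ_[p]) ^ 2 * a' ∣ p ^ n := by
    have h1 := PadicInt.unitCoeff_spec ha0
    obtain ⟨v, hv⟩ := (PadicInt.unitCoeff ha0).isUnit.exists_right_inv
    refine ⟨v, ?_⟩
    conv_rhs => rw [h1]
    rw [hn]
    linear_combination (-(p : ℤ_[p]) ^ (a'.valuation + 2)) * hv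
  set N := a'.appr n with hN
  have h1 := PadicInt.appr_spec n a'
  rw [← hN, Ideal.mem_span_singleton] at h1
  obtain ⟨x, hx⟩ := dvd_trans hval2 h1
  have h2 := hcpwhat a' n
  rw [← hN, Ideal.mem_span_singleton] at h2
  have hv3 := map_dvd (iota p) hval2
  simp only [map_mul, map_pow, map_natCast] at hv3
  obtain ⟨y, hy⟩ := dvd_trans hv3 h2
  obtain ⟨r, hr⟩ := pow_expand2 p (iota p) w hw (-(u * chat)) N
  have hch : chat = 1 + (qq p : Wp p) * (-(u * chat)) := by
    rw [hc] at hchat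
    linear_combination hchat
  rw [← hch] at hr
  have hxN : (N : Wp p) = iota p a' - p ^ 2 * iota p a' * iota p x := by
    have := congrArg (iota p) hx
    simp only [map_mul, map_pow, map_natCast, map_sub] at this
    linear_combination -this
  rw [hr] at hy
  set α := iota p a'
  set ω := iota p (w 1)
  set ξ := iota p x
  refine ⟨y + (1 - p ^ 2 * ξ) * r + p * ξ * ω * u * chat + ω * u * ω * u * chat, ?_⟩
  rw [hq] at hch
  rw [hxN] at hy
  linear_combination hy - p * α * ω * u * hch

/-- the transformation formula holds modulo `p`: the coefficients of
`G^{(σ)}_{a,…,a}(t)` and `Ĝ^{(σ̂)}_{a,…,a}(t)` satisfy `B^G_k ∈ pW` and `B̂_k ∈ pW` for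
`l < k ≤ p−1`, and `B^G_k + (−1)^{ls} B̂_{l−k} ∈ pW` for `0 ≤ k ≤ l`; equivalently
`G^{(σ)}_{a,…,a}(t)_{<p} + (−1)^{ls} t^l Ĝ^{(σ̂)}_{a,…,a}(t⁻¹)_{<p} ≡ 0 mod p W[t,t⁻¹]`. -/
theorem statement19 (p : ℕ) [Fact p.Prime] (s : ℕ) (hs : 1 ≤ s)
    (a a' : ℤ_[p]) (ha : NotNonposInt p a) (ha' : IsDworkPrime p a a')
    (A A1 : ℕ → ℤ_[p]) (hA : IsHGCoeff p s a A) (hA1 : IsHGCoeff p s a' A1)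
    (u c chat : Wp p) (hc : c = 1 + (qq p : Wp p) * u) (hchat : c * chat = 1)
    (cpwhat : ℤ_[p] → Wp p) (hcpwhat : IsCpow p chat cpwhat)
    (Bhat : ℕ → Wp p) (hBhat : IsBhat p s a a' A A1 cpwhat Bhat)
    (D : ℤ_[p] → ℚ_[p]) (hDcont : Continuous D)
    (hDval : ∀ m : ℕ, D (1 + (m : ℤ_[p])) =
      ∑ j ∈ (Finset.Icc 1 m).filter (fun j => ¬ (p ∣ j)), ((j : ℚ_[p]))⁻¹)
    (Da : ℤ_[p]) (hDa : (Da : ℚ_[p]) = D a)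
    (w : ℕ → ℤ_[p])
    (hw : ∀ i : ℕ, 1 ≤ i → ((i : ℤ_[p]) * (p : ℤ_[p])) * w i = ((qq p : ℤ_[p])) ^ i)
    (Lg : Wp p)
    (hLg : WLim p (fun n => ∑ i ∈ Finset.Icc 1 n, (-1 : Wp p) ^ (i + 1) * iota p (w i) * u ^ i) Lg)
    (BG : ℕ → Wp p) (hBG0 : BG 0 = (s : Wp p) * iota p Da - Lg)
    (hBGk : ∀ k : ℕ, 1 ≤ k → (k : Wp p) * BG k =
      iota p (A k) - (if p ∣ k then c ^ (k / p) * iota p (A1 (k / p)) else 0)) :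
    (∀ k : ℕ, dl p a < k → k ≤ p - 1 →
      BG k ∈ Ideal.span {(p : Wp p)} ∧ Bhat k ∈ Ideal.span {(p : Wp p)}) ∧
    (∀ k : ℕ, k ≤ dl p a →
      BG k + (-1 : Wp p) ^ (dl p a * s) * Bhat (dl p a - k) ∈ Ideal.span {(p : Wp p)}) := by
  have hlp := dl_lt p a
  have hp2 : 2 ≤ p := (Fact.out : p.Prime).two_le
  have hx : (p : Wp p) * iota p a' = iota p a + (dl p a : Wp p) := by
    have := congrArg (iota p) ha'
    simpa using this
  have hnd : ∀ k : ℕ, 1 ≤ k → k < p → ¬ p ∣ k := fun k h1 h2 h3 => by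
    have := Nat.le_of_dvd (by omega) h3
    omega
  refine ⟨?_, ?_⟩
  · intro k hk hkp
    rw [Ideal.mem_span_singleton, Ideal.mem_span_singleton]
    have hA' := iota_dvd p _ (A_big p s hs a a' ha' A hA k hk (by omega))
    constructor
    · apply coprime_dvd p k (hnd k (by omega) (by omega))
      rw [hBGk k (by omega), if_neg (hnd k (by omega) (by omega)), sub_zero]
      exact hA'
    · have h := hBhat k
      rw [if_neg (fun h => hnd (k - dl p a) (by omega) (by omega) h.2), sub_zero] at h
      apply coprime_dvd p (k - dl p a) (hnd _ (by omega) (by omega))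
      rw [Nat.cast_sub hk.le]
      have : ((k : Wp p) - (dl p a : Wp p)) * Bhat k
          = iota p (A k) - p * (iota p a' * Bhat k) := by
        linear_combination h + Bhat k * hx
      rw [this]
      exact dvd_sub hA' (dvd_mul_right _ _)
  · intro k hk
    rw [Ideal.mem_span_singleton]
    rcases Nat.eq_zero_or_pos k with rfl | hk0
    · rw [Nat.sub_zero]
      have ha0 : a' ≠ 0 := by
        rintro rfl
        have h1 : (p : ℤ_[p]) * 0 = a + (dl p a : ℤ_[p]) := ha'
        rw [mul_zero] at h1
        exact ha _ h1.symm
      obtain ⟨h, r1, hh, hr1⟩ := A_l p s a a' ha' A hA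
      obtain ⟨r2, hr2⟩ := cpow_mod p a' ha0 u c chat hc hchat cpwhat hcpwhat w hw
      obtain ⟨d, r3, hd, hr3⟩ := sign_lem p s a a' ha'
      obtain ⟨r4, hr4⟩ := Lg_mod p u w hw Lg hLg
      have hD := D_mod p a a' ha' D hDcont hDval Da hDa
      obtain ⟨r5, hr5⟩ := iota_dvd p _ (dvd_of_toZMod_eq p Da (h - d) (by
        rw [map_sub, hD, hh, hd]; ring))
      have hA10 : A1 0 = 1 := by simpa using hA1 0
      have hB := hBhat (dl p a)
      rw [if_pos ⟨le_rfl, by simp⟩] at hB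
      simp only [Nat.sub_self, Nat.zero_div, Nat.cast_zero, zero_add, hA10, map_one, mul_one] at hB
      have hr1' := congrArg (iota p) hr1
      have hr3' := congrArg (iota p) hr3
      simp only [map_mul, map_pow, map_natCast, map_sub, map_add, map_one, map_neg] at hr1' hr3' hr5
      have hne : (p : Wp p) * iota p a' ≠ 0 := by
        have h1 : (p : ℤ_[p]) * a' ≠ 0 :=
          mul_ne_zero (by exact_mod_cast (Fact.out : p.Prime).ne_zero) ha0
        have := (map_ne_zero_iff (iota p) (iota_inj p)).2 h1
        simpa using this
      rw [hr1', hr3', hr2] at hB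
      have he : ((-1 : Wp p) ^ (dl p a * s)) * (-1 : Wp p) ^ (dl p a * s) = 1 := by
        rw [← mul_pow]; simp
      set ε := (-1 : Wp p) ^ (dl p a * s)
      set α := iota p a'
      set ω := iota p (w 1)
      set η := iota p h
      set κ := iota p d
      set ρ1 := iota p r1
      set ρ3 := iota p r3
      have hfin : ε * Bhat (dl p a) = - s * η + p * α * ρ1 + ω * u - p * r2
          + (s * κ - p * ρ3) * (1 - p * α * ω * u + p ^ 2 * α * r2) := by
        apply mul_left_cancel₀ hne
        linear_combination ε * hB + ε * Bhat (dl p a) * hx +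
          ((1 - s * (p * α) * η + (p * α) ^ 2 * ρ1) - (1 - p * α * s * κ + p ^ 2 * α * ρ3) *
            (1 - p * α * ω * u + p ^ 2 * α * r2)) * he
      rw [hBG0, hfin]
      refine ⟨s * r5 - r4 + α * ρ1 - r2 - ρ3 * (1 - p * α * ω * u + p ^ 2 * α * r2)
        + s * κ * (- α * ω * u + p * α * r2), ?_⟩
      linear_combination s * hr5 - hr4
    · apply coprime_dvd p k (hnd k hk0 (by omega))
      have h1 := hBGk k hk0
      rw [if_neg (hnd k hk0 (by omega)), sub_zero] at h1
      have h2 := hBhat (dl p a - k)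
      rw [if_neg (fun h => by omega), sub_zero, Nat.cast_sub hk] at h2
      obtain ⟨r, hr⟩ := iota_dvd p _ (dvd_of_toZMod_eq p (A k)
          ((-1) ^ (dl p a * s) * A (dl p a - k)) (by
        rw [map_mul, A_small p s a a' ha' A hA k hk,
          A_small p s a a' ha' A hA (dl p a - k) (by omega), Nat.choose_symm hk, pow_mul, map_pow,
          map_pow, map_neg, map_one, ← mul_pow]
        congr 1
        rw [← mul_assoc, ← pow_add]
        congr 1
        rw [show dl p a + (dl p a - k) = k + 2 * (dl p a - k) by omega, pow_add, pow_mul]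
        simp))
      simp only [map_mul, map_pow, map_sub, map_one, map_neg] at hr
      refine ⟨r + (-1) ^ (dl p a * s) * iota p a' * Bhat (dl p a - k), ?_⟩
      linear_combination h1 + hr - (-1) ^ (dl p a * s) * h2
        - (-1) ^ (dl p a * s) * Bhat (dl p a - k) * hx

end HGP
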